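/- arXiv:2407.18353 — 2 statements merged into one kernel-verified Lean document; each statement's English description precedes it below -/
import Mathlib

section
/- Collusion resistance of additive secret sharing: let q ≥ 1 and m ≥ 1, let x ∈ ZMod q be a secret, and let the share vector s : Fin m → ZMod q be generated from a uniformly random a : Fin (m-1) → ZMod q by setting s j = a j for the first m−1 indices and s (last) = x − ∑_j a j. Then for every index t : Fin m, the pushforward of the uniform PMF on (Fin (m-1) → ZMod q) under the map a ↦ (the restriction of s to the m−1 indices different from t) is the uniform PMF on ({j : Fin m // j ≠ t} → ZMod q). In particular, any m−1 of the m shares are jointly uniformly distributed and their joint distribution does not depend on the secret x. -/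
theorem map_uniform_of_bijective {α β : Type*} [Fintype α] [Fintype β] [Nonempty α] [Nonempty β]
    (f : α → β) (hf : Function.Bijective f) :
    PMF.map f (PMF.uniformOfFintype α) = PMF.uniformOfFintype β := by
  classical
  ext b
  obtain ⟨a, rfl⟩ := hf.2 b
  rw [PMF.map_apply, tsum_eq_single a]
  · simp [Fintype.card_of_bijective hf]
  · intro a' ha
    rw [if_neg]
    exact fun h => ha (hf.1 h.symm)

/-- Collusion resistance of `m`-of-`m` additive secret sharing: generate the
share vector `s : Fin m → ZMod q` from a uniformly random
`a : Fin (m-1) → ZMod q` by `s j = a j` on the first `m - 1` indices and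
`s last = x - ∑ j, a j`.  For every index `t`, the joint distribution of the
`m - 1` shares `{j // j ≠ t}` is the uniform PMF on
`({j : Fin m // j ≠ t} → ZMod q)`; in particular it does not depend on the
secret `x`. -/
theorem additive_sharing_collusion_resistant (q m : ℕ) [NeZero q]
    (hm : 1 ≤ m) (x : ZMod q) (t : Fin m) :
    PMF.map
        (fun a : Fin (m - 1) → ZMod q =>
          fun j : {j : Fin m // j ≠ t} =>
            if h : (j.1 : ℕ) < m - 1 then a ⟨j.1, h⟩ else x - ∑ i, a i)
        (PMF.uniformOfFintype (Fin (m - 1) → ZMod q))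
      = PMF.uniformOfFintype ({j : Fin m // j ≠ t} → ZMod q) := by
  apply map_uniform_of_bijective
  rw [Fintype.bijective_iff_injective_and_card]
  refine ⟨?_, ?_⟩
  · intro a b hab
    have key : ∀ i : Fin (m - 1), (i : ℕ) ≠ t → a i = b i := by
      intro i hi
      have h := congrFun hab ⟨⟨i, by omega⟩, fun h => hi (congrArg Fin.val h)⟩
      simpa using h
    funext i
    by_cases hi : (i : ℕ) = t
    · have hs : ∑ i, a i = ∑ i, b i := by
        have h := congrFun hab ⟨⟨m - 1, by omega⟩, fun h => by
          have := congrArg Fin.val h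
          simp only at this
          omega⟩
        simpa using h
      rw [← Finset.add_sum_erase _ a (Finset.mem_univ i),
        ← Finset.add_sum_erase _ b (Finset.mem_univ i)] at hs
      have h2 : ∑ j ∈ Finset.univ.erase i, a j = ∑ j ∈ Finset.univ.erase i, b j := by
        apply Finset.sum_congr rfl
        intro j hj
        apply key
        intro h
        exact (Finset.mem_erase.1 hj).1 (Fin.ext (h.trans hi.symm))
      rw [h2] at hs
      exact add_right_cancel hs
    · exact key i hi
  · simp [Fintype.card_subtype_compl]
end

section
/- Correctness of the privateMDI online phase for a purely linear model: let q ≥ 1 and let Mₗ (for l = 1,…,L) be n×n matrices over ZMod q, let s : Fin L → (Fin n → ZMod q) be the cloud server's masks, and define the offline mask recursion c₁ = r₁ and c_{l+1} = Mₗ.mulVec cₗ + sₗ. Define the online values by y₁ = x − c₁ and y_{l+1} = Mₗ.mulVec yₗ − sₗ. Then for every l, yₗ = (M_{l-1}⋯M₁).mulVec x − cₗ; in particular, after the client adds the final mask, y_{L+1} + c_{L+1} = (M_L ⋯ M₁).mulVec x, i.e., the client obtains the correct model output M(x). -/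
/-- The product `M_{l-1} ⋯ M₁` of the first `l` layer matrices (0-indexed:
`M (l-1) * ⋯ * M 0`), with `matChain M 0 = 1`. -/
def matChain {n L : ℕ} {R : Type*} [CommRing R]
    (M : Fin L → Matrix (Fin n) (Fin n) R) : ℕ → Matrix (Fin n) (Fin n) R
  | 0 => 1
  | l + 1 => if h : l < L then M ⟨l, h⟩ * matChain M l else matChain M l

/-- Correctness of the privateMDI online phase for a purely linear model:
with offline masks `c 0 = r₁`, `c (l+1) = Mₗ cₗ + sₗ`, and online values
`y 0 = x - c 0`, `y (l+1) = Mₗ yₗ - sₗ`, every intermediate value satisfies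
`y l = (M_{l-1} ⋯ M₁) x - c l`; in particular, after the client adds the final
mask, `y (last) + c (last) = (M_L ⋯ M₁) x`, the correct model output. -/
theorem privateMDI_linear_correct (q n L : ℕ) [NeZero q]
    (M : Fin L → Matrix (Fin n) (Fin n) (ZMod q))
    (s : Fin L → (Fin n → ZMod q))
    (r₁ x : Fin n → ZMod q)
    (c y : Fin (L + 1) → (Fin n → ZMod q))
    (hc0 : c 0 = r₁)
    (hc : ∀ l : Fin L, c l.succ = (M l).mulVec (c l.castSucc) + s l)
    (hy0 : y 0 = x - c 0)
    (hy : ∀ l : Fin L, y l.succ = (M l).mulVec (y l.castSucc) - s l) :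
    (∀ l : Fin (L + 1), y l = (matChain M (l : ℕ)).mulVec x - c l) ∧
    y (Fin.last L) + c (Fin.last L) = (matChain M L).mulVec x := by
  have key : ∀ l : Fin (L + 1), y l = (matChain M (l : ℕ)).mulVec x - c l := by
    intro l
    induction l using Fin.induction with
    | zero => simp [matChain, hy0]
    | succ i ih =>
      have h : matChain M ((i.succ : Fin (L + 1)) : ℕ) = M i * matChain M (i : ℕ) := by
        simp [matChain]
      rw [Fin.val_castSucc] at ih
      rw [hy, hc, ih, h, Matrix.mulVec_sub, Matrix.mulVec_mulVec]
      abel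
  refine ⟨key, ?_⟩
  rw [key (Fin.last L), Fin.val_last, sub_add_cancel]
end
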